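/- arXiv:1502.06777 — 2 statements merged into one kernel-verified Lean document; each statement's English description precedes it below -/
import Mathlib

section
/- For every input sequence u : ℤ → ℝ, every n ∈ ℤ, and every choice of coefficients g_1, …, g_P ∈ ℝ, the Wiener-Hammerstein model output satisfies the identity Σ_{p=1}^{P} g_p Σ_{r=0}^{R−1} h_r ( Σ_{m=r}^{L_w+r−1} w_{m−r} u(n−m) )^p = Σ_{p=1}^{P} Σ_{m_1=0}^{M−1} ⋯ Σ_{m_p=0}^{M−1} k^{(p)}(m_1,…,m_p) ∏_{q=1}^{p} u(n−m_q), where the Volterra kernels are given by k^{(p)}(m_1,…,m_p) = g_p Σ_{l=0}^{R−1} h_l ∏_{q=1}^{p} w̄(m_q − l). -/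
/-- A sum over an integer interval contained in `[0, M)` equals the sum over `Fin M`
when the summand vanishes off the interval. -/
theorem Finset.sum_intIcc_eq_sum_fin {A : Type*} [AddCommMonoid A] {M : ℕ} {a b : ℤ}
    (ha : 0 ≤ a) (hb : b < M) (f : ℤ → A) (hf : ∀ j, j < a ∨ b < j → f j = 0) :
    ∑ m ∈ Finset.Icc a b, f m = ∑ m : Fin M, f (m : ℤ) := by
  symm
  have hsub : Finset.Icc a b ⊆ Finset.Ico 0 (M : ℤ) := by
    intro x hx
    simp only [Finset.mem_Icc, Finset.mem_Ico] at hx ⊢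
    omega
  rw [Finset.sum_subset hsub fun x _ hx => hf x (by
    simp only [Finset.mem_Icc] at hx
    omega)]
  refine Finset.sum_of_injOn (fun m : Fin M => (m : ℤ)) ?_ ?_ ?_ fun _ _ => rfl
  · intro x _ y _ hxy
    exact Fin.ext (Int.ofNat.inj hxy)
  · intro x _
    simp
  · intro i hi hni
    rw [Finset.mem_Ico] at hi
    refine absurd ⟨⟨i.toNat, by omega⟩, Finset.mem_coe.2 (Finset.mem_univ _), ?_⟩ hni
    exact Int.toNat_of_nonneg hi.1

/-- Let `Lw ≥ 1` and `R ≥ 1` be integers, `M = Lw + R - 1`, `w ∈ ℝ^{Lw}`, `h ∈ ℝ^R`,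
and let `wbar : ℤ → ℝ` be the zero-extension of `w`.  For every input sequence
`u : ℤ → ℝ`, every `n ∈ ℤ` and every choice of coefficients `g 1, …, g P ∈ ℝ`,
the Wiener-Hammerstein model output satisfies
`Σ_{p=1}^{P} g_p Σ_{r=0}^{R−1} h_r (Σ_{m=r}^{Lw+r−1} w_{m−r} u(n−m))^p
  = Σ_{p=1}^{P} Σ_{m_1=0}^{M−1} ⋯ Σ_{m_p=0}^{M−1} k⁽ᵖ⁾(m_1,…,m_p) ∏_{q=1}^{p} u(n−m_q)`,
where `k⁽ᵖ⁾(m_1,…,m_p) = g_p Σ_{l=0}^{R−1} h_l ∏_{q=1}^{p} wbar (m_q − l)`. -/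
theorem wiener_hammerstein_equiv_volterra
    (Lw R : ℕ) (hLw : 1 ≤ Lw) (hR : 1 ≤ R) (M : ℕ) (hM : M = Lw + R - 1)
    (w : Fin Lw → ℝ) (h : Fin R → ℝ)
    (wbar : ℤ → ℝ)
    (hw1 : ∀ j : Fin Lw, wbar (j : ℤ) = w j)
    (hw0 : ∀ j : ℤ, (j < 0 ∨ (Lw : ℤ) ≤ j) → wbar j = 0)
    (P : ℕ) (g : ℕ → ℝ) (u : ℤ → ℝ) (n : ℤ) :
    (∑ p ∈ Finset.Icc 1 P, g p *
      ∑ r : Fin R, h r *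
        (∑ m ∈ Finset.Icc (r : ℤ) ((r : ℤ) + (Lw : ℤ) - 1), wbar (m - (r : ℤ)) * u (n - m)) ^ p)
    =
    ∑ p ∈ Finset.Icc 1 P, ∑ m : Fin p → Fin M,
      (g p * ∑ l : Fin R, h l * ∏ q : Fin p, wbar ((m q : ℤ) - (l : ℤ))) *
        ∏ q : Fin p, u (n - (m q : ℤ)) := by
  refine Finset.sum_congr rfl fun p _ => ?_
  have hinner (r : Fin R) :
      ∑ m ∈ Finset.Icc (r : ℤ) ((r : ℤ) + (Lw : ℤ) - 1), wbar (m - (r : ℤ)) * u (n - m) =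
        ∑ m : Fin M, wbar ((m : ℤ) - (r : ℤ)) * u (n - (m : ℤ)) := by
    have hr := r.isLt
    refine Finset.sum_intIcc_eq_sum_fin (by omega) (by omega)
      (fun m => wbar (m - (r : ℤ)) * u (n - m)) fun j hj => ?_
    rw [hw0 _ (by omega), zero_mul]
  simp_rw [hinner, Fintype.sum_pow, Finset.prod_mul_distrib, Finset.mul_sum, Finset.sum_mul]
  rw [Finset.sum_comm]
  refine Finset.sum_congr rfl fun m _ => Finset.sum_congr rfl fun l _ => ?_
  ring
end

section
/- For every p ≥ 1 and all indices m_1, …, m_p ∈ {0, …, M−1}, one has Σ_{l=l_0}^{L} h_l ∏_{q=1}^{p} w_{m_q − l} = Σ_{r=1}^{R} h_{r−1} ∏_{q=1}^{p} (S_r w)_{m_q + 1}, where l_0 = max{0, m_1 − L_w + 1, …, m_p − L_w + 1} and L = min{R−1, m_1, …, m_p}, with the convention that the left-hand sum is 0 when l_0 > L. In particular, every index m_q − l appearing on the left lies in {0, …, L_w − 1}, and the Volterra kernel of the Wiener-Hammerstein model coincides with a canonical polyadic decomposition whose factors have as columns the shifted vectors S_r w. -/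
/-- The selection matrix `S_r ∈ ℝ^{M×Lw}` whose columns are the canonical basis
vectors `e_r, …, e_{Lw+r-1}` of `ℝ^M` (here written with 0-based indices: the
`l`-th column is the canonical basis vector with a `1` in position `r + l`). -/
def selMat (Lw R M : ℕ) (r : Fin R) : Matrix (Fin M) (Fin Lw) ℝ :=
  Matrix.of fun m l => if (m : ℕ) = (r : ℕ) + (l : ℕ) then 1 else 0

/-- The entries of `S_r w` are the values of the zero-extension of `w`, shifted by `r`. -/
theorem selMat_mulVec_apply {Lw R M : ℕ} (w : Fin Lw → ℝ) (wbar : ℤ → ℝ)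
    (hw1 : ∀ j : Fin Lw, wbar (j : ℤ) = w j)
    (hw0 : ∀ j : ℤ, (j < 0 ∨ (Lw : ℤ) ≤ j) → wbar j = 0)
    (r : Fin R) (m : Fin M) :
    ((selMat Lw R M r).mulVec w) m = wbar ((m : ℤ) - ((r : ℕ) : ℤ)) := by
  simp only [Matrix.mulVec, dotProduct, selMat, Matrix.of_apply, ite_mul, one_mul, zero_mul]
  by_cases hm : (r : ℕ) ≤ m ∧ (m : ℕ) < r + Lw
  · obtain ⟨j, hj⟩ : ∃ j : Fin Lw, (m : ℕ) = r + j := ⟨⟨m - r, by omega⟩, by simp; omega⟩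
    have hmj : (m : ℤ) - ((r : ℕ) : ℤ) = (j : ℤ) := by omega
    rw [hmj, hw1, Finset.sum_eq_single j]
    · simp [hj]
    · intro b _ hb
      exact if_neg fun h => hb (Fin.ext (by omega))
    · simp
  · rw [hw0 _ (by omega)]
    exact Finset.sum_eq_zero fun j _ => if_neg (by omega)

/-- The summation range consists of the `l < R` for which all shifted indices are in range. -/
theorem mem_Icc_sup_min_inf'_iff {ι : Type*} {s : Finset ι} (hs : s.Nonempty) {Lw R : ℕ}
    (hR : 1 ≤ R) (m : ι → ℕ) (l : ℕ) :
    l ∈ Finset.Icc (s.sup fun q => m q + 1 - Lw) (min (R - 1) (s.inf' hs m)) ↔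
      l < R ∧ ∀ q ∈ s, l ≤ m q ∧ m q < l + Lw := by
  simp only [Finset.mem_Icc, Finset.sup_le_iff, le_min_iff, Finset.le_inf'_iff]
  constructor
  · rintro ⟨h₁, h₂, h₃⟩
    exact ⟨by omega, fun q hq => ⟨h₃ q hq, by have := h₁ q hq; omega⟩⟩
  · rintro ⟨h₁, h₂⟩
    exact ⟨fun q hq => by have := h₂ q hq; omega, by omega, fun q hq => (h₂ q hq).1⟩

/-- For every `p ≥ 1` and all indices `m_1, …, m_p ∈ {0, …, M−1}`,
`Σ_{l=l0}^{L} h_l ∏_{q=1}^{p} w_{m_q−l} = Σ_{r=1}^{R} h_{r−1} ∏_{q=1}^{p} (S_r w)_{m_q+1}`,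
where `l0 = max{0, m_1 − Lw + 1, …, m_p − Lw + 1}` and `L = min{R−1, m_1, …, m_p}`
(the left-hand sum being `0` when `l0 > L`).  In particular, every index
`m_q − l` appearing on the left lies in `{0, …, Lw − 1}`.  Here `wbar` and
`hbar` denote the zero-extensions of `w` and `h`. -/
theorem volterra_kernel_structured_cpd
    (Lw R : ℕ) (hLw : 1 ≤ Lw) (hR : 1 ≤ R) (M : ℕ) (hM : M = Lw + R - 1)
    (w : Fin Lw → ℝ) (h : Fin R → ℝ)
    (wbar : ℤ → ℝ)
    (hw1 : ∀ j : Fin Lw, wbar (j : ℤ) = w j)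
    (hw0 : ∀ j : ℤ, (j < 0 ∨ (Lw : ℤ) ≤ j) → wbar j = 0)
    (hbar : ℕ → ℝ)
    (hh1 : ∀ l : Fin R, hbar (l : ℕ) = h l)
    (hh0 : ∀ l : ℕ, R ≤ l → hbar l = 0)
    (p : ℕ) (hp : 1 ≤ p) (m : Fin p → Fin M)
    (l0 L : ℕ)
    (hl0 : l0 = Finset.univ.sup (fun q : Fin p => (m q : ℕ) + 1 - Lw))
    (hL : L = min (R - 1)
        (Finset.univ.inf' (Finset.univ_nonempty_iff.mpr ⟨⟨0, hp⟩⟩)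
          (fun q : Fin p => (m q : ℕ)))) :
    (∀ l ∈ Finset.Icc l0 L, ∀ q : Fin p,
        (0 : ℤ) ≤ (m q : ℤ) - (l : ℤ) ∧ (m q : ℤ) - (l : ℤ) ≤ (Lw : ℤ) - 1) ∧
    (∑ l ∈ Finset.Icc l0 L, hbar l * ∏ q : Fin p, wbar ((m q : ℤ) - (l : ℤ)))
      = ∑ r : Fin R, h r * ∏ q : Fin p, ((selMat Lw R M r).mulVec w) (m q) := by
  have hmem : ∀ l, l ∈ Finset.Icc l0 L ↔
      l < R ∧ ∀ q : Fin p, l ≤ (m q : ℕ) ∧ (m q : ℕ) < l + Lw := by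
    intro l
    rw [hl0, hL, mem_Icc_sup_min_inf'_iff _ hR]
    simp
  refine ⟨fun l hl q => ?_, ?_⟩
  · have := ((hmem l).1 hl).2 q
    omega
  · simp only [selMat_mulVec_apply w wbar hw1 hw0, ← hh1]
    rw [Fin.sum_univ_eq_sum_range
      (fun l : ℕ => hbar l * ∏ q : Fin p, wbar ((m q : ℤ) - (l : ℤ))) R]
    refine Finset.sum_subset (fun l hl => Finset.mem_range.2 ((hmem l).1 hl).1) ?_
    intro l hlR hl
    rw [hmem, not_and, not_forall] at hl
    obtain ⟨q, hq⟩ := hl (Finset.mem_range.1 hlR)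
    rw [Finset.prod_eq_zero (Finset.mem_univ q) (hw0 _ (by omega)), mul_zero]
end
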